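/- Fix (l₁,l₂) ∈ ℤ² and x = (x₁,x₂) ∈ (0,1)². For η ∈ ℝ with sin(S⁻¹_{l₁,l₂}(η)) ≠ 0 and t ∈ ℝ, define θ = S⁻¹_{l₁,l₂}(η) and y(η,t) = R⁻¹_{l₁,l₂}( x₁ + (l₂ − x₂) cot θ, l₂ ) + t(cos η, sin η). Then the Jacobian determinant of the map (η,t) ↦ y(η,t) satisfies |det D_{(η,t)} y| = |(l₂ − x₂)/sin θ + t|; and if moreover t ≥ 0 and (l₂ − x₂)/sin θ > 0, then |det D_{(η,t)} y| = |R_{l₁,l₂}(y(η,t)) − x|. -/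

import Mathlib

open Set

noncomputable section

namespace BRT15

/-- The unfolding map `R_{l₁,l₂}` onto the tile `[l₁,l₁+1] × [l₂,l₂+1]`. -/
def Rmap (l₁ l₂ : ℤ) (w : ℝ × ℝ) : ℝ × ℝ :=
  ((l₁ : ℝ) + (1 - (-1:ℝ) ^ l₁) / 2 + (-1:ℝ) ^ l₁ * w.1,
   (l₂ : ℝ) + (1 - (-1:ℝ) ^ l₂) / 2 + (-1:ℝ) ^ l₂ * w.2)

/-- The explicit inverse unfolding map `R⁻¹_{l₁,l₂}`. -/
def Rinv (l₁ l₂ : ℤ) (w : ℝ × ℝ) : ℝ × ℝ :=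
  ((-1:ℝ) ^ (l₁ + 1) * (l₁ : ℝ) + (1 - (-1:ℝ) ^ l₁) / 2 + (-1:ℝ) ^ l₁ * w.1,
   (-1:ℝ) ^ (l₂ + 1) * (l₂ : ℝ) + (1 - (-1:ℝ) ^ l₂) / 2 + (-1:ℝ) ^ l₂ * w.2)

/-- The explicit inverse reflected-angle map `S⁻¹_{l₁,l₂}`. -/
def Sinv (l₁ l₂ : ℤ) (η : ℝ) : ℝ :=
  (-1:ℝ) ^ l₂ * ((-1:ℝ) ^ l₁ * η + ((1 - (-1:ℝ) ^ l₁) / 2) * Real.pi)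

/-- Euclidean norm on `ℝ × ℝ`. -/
def enorm2 (a : ℝ × ℝ) : ℝ := Real.sqrt (a.1 ^ 2 + a.2 ^ 2)

/-- The reflection point `z(x,η)` on the boundary, obtained by folding back the
intersection of the unfolded ray from `x` with angle `θ = S⁻¹_{l₁,l₂}(η)` with the
horizontal line `{w₂ = l₂}`. -/
def zOfEta (l₁ l₂ : ℤ) (x : ℝ × ℝ) (η : ℝ) : ℝ × ℝ :=
  Rinv l₁ l₂
    (x.1 + ((l₂ : ℝ) - x.2) * (Real.cos (Sinv l₁ l₂ η) / Real.sin (Sinv l₁ l₂ η)),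
     (l₂ : ℝ))

/-- The point `y(η,t) = z(x,η) + t (cos η, sin η)` along the reflected segment. -/
def yOf (l₁ l₂ : ℤ) (x : ℝ × ℝ) (p : ℝ × ℝ) : ℝ × ℝ :=
  zOfEta l₁ l₂ x p.1 + p.2 • (Real.cos p.1, Real.sin p.1)

theorem neg_one_zpow_succ (l : ℤ) : (-1:ℝ) ^ (l + 1) = -(-1:ℝ) ^ l := by
  rw [zpow_add₀ (by norm_num)]
  simp

theorem neg_one_zpow_eq_or (l : ℤ) : (-1:ℝ) ^ l = 1 ∨ (-1:ℝ) ^ l = -1 := by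
  rcases Int.even_or_odd l with h | h
  · exact Or.inl h.neg_one_zpow
  · exact Or.inr h.neg_one_zpow

theorem neg_one_zpow_sq (l : ℤ) : ((-1:ℝ) ^ l) ^ 2 = 1 := by
  rcases neg_one_zpow_eq_or l with h | h <;> simp [h]

theorem cos_Sinv (l₁ l₂ : ℤ) (η : ℝ) :
    Real.cos (Sinv l₁ l₂ η) = (-1:ℝ) ^ l₁ * Real.cos η := by
  unfold Sinv
  rcases neg_one_zpow_eq_or l₁ with h₁ | h₁ <;> rcases neg_one_zpow_eq_or l₂ with h₂ | h₂ <;>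
    norm_num [h₁, h₂, Real.cos_add, Real.sin_add]

theorem sin_Sinv (l₁ l₂ : ℤ) (η : ℝ) :
    Real.sin (Sinv l₁ l₂ η) = (-1:ℝ) ^ l₂ * Real.sin η := by
  unfold Sinv
  rcases neg_one_zpow_eq_or l₁ with h₁ | h₁ <;> rcases neg_one_zpow_eq_or l₂ with h₂ | h₂ <;>
    norm_num [h₁, h₂, Real.cos_add, Real.sin_add]

/-- Cartesian form of `y(η,t)`, with the trigonometric functions of `θ` expressed through `η`. -/
theorem yOf_eq (l₁ l₂ : ℤ) (x p : ℝ × ℝ) :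
    yOf l₁ l₂ x p =
      (-(-1:ℝ) ^ l₁ * l₁ + (1 - (-1:ℝ) ^ l₁) / 2 + (-1:ℝ) ^ l₁ * x.1 +
          (-1:ℝ) ^ l₂ * ((l₂ : ℝ) - x.2) * (Real.cos p.1 / Real.sin p.1) + p.2 * Real.cos p.1,
        (1 - (-1:ℝ) ^ l₂) / 2 + p.2 * Real.sin p.1) := by
  have h₁ := neg_one_zpow_sq l₁
  have h₂ : ((-1:ℝ) ^ l₂)⁻¹ = (-1:ℝ) ^ l₂ := by
    rcases neg_one_zpow_eq_or l₂ with h | h <;> norm_num [h]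
  simp only [yOf, zOfEta, Rinv, neg_one_zpow_succ, cos_Sinv, sin_Sinv, div_eq_mul_inv, mul_inv, h₂,
    Prod.smul_mk, Prod.mk_add_mk, smul_eq_mul, Prod.mk.injEq]
  constructor
  · linear_combination
      ((l₂ : ℝ) - x.2) * (-1:ℝ) ^ l₂ * Real.cos p.1 * (Real.sin p.1)⁻¹ * h₁
  · ring

/-- Unfolding `y(η,t)` gives the point at signed distance `(l₂ - x₂)/sin θ + t` from `x`
in the direction `θ`. -/
theorem Rmap_yOf_sub (l₁ l₂ : ℤ) (x : ℝ × ℝ) (η t : ℝ) (hsin : Real.sin (Sinv l₁ l₂ η) ≠ 0) :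
    Rmap l₁ l₂ (yOf l₁ l₂ x (η, t)) - x =
      (((l₂ : ℝ) - x.2) / Real.sin (Sinv l₁ l₂ η) + t) •
        (Real.cos (Sinv l₁ l₂ η), Real.sin (Sinv l₁ l₂ η)) := by
  have hs : Real.sin η ≠ 0 := by
    rw [sin_Sinv] at hsin
    exact right_ne_zero_of_mul hsin
  ext
  · simp only [yOf_eq, Rmap, cos_Sinv, sin_Sinv, Prod.fst_sub, Prod.smul_fst, smul_eq_mul]
    rcases neg_one_zpow_eq_or l₁ with h₁ | h₁ <;> rcases neg_one_zpow_eq_or l₂ with h₂ | h₂ <;>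
      rw [h₁, h₂] <;> field_simp <;> ring
  · simp only [yOf_eq, Rmap, sin_Sinv, Prod.snd_sub, Prod.smul_snd, smul_eq_mul]
    rcases neg_one_zpow_eq_or l₂ with h₂ | h₂ <;> rw [h₂] <;> field_simp <;> ring

theorem enorm2_smul_cos_sin (r θ : ℝ) : enorm2 (r • (Real.cos θ, Real.sin θ)) = |r| := by
  rw [enorm2, ← Real.sqrt_sq_eq_abs]
  congr 1
  simp only [Prod.smul_mk, smul_eq_mul]
  linear_combination r ^ 2 * Real.cos_sq_add_sin_sq θ

/-- The Jacobian matrix of `(η,t) ↦ y(η,t)`. -/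
def jacobianMatrix (l₂ : ℤ) (x : ℝ × ℝ) (η t : ℝ) : Matrix (Fin 2) (Fin 2) ℝ :=
  !![-((-1:ℝ) ^ l₂ * ((l₂ : ℝ) - x.2) / Real.sin η ^ 2) - t * Real.sin η, Real.cos η;
    t * Real.cos η, Real.sin η]

theorem det_jacobianMatrix (l₁ l₂ : ℤ) (x : ℝ × ℝ) (η t : ℝ)
    (hsin : Real.sin (Sinv l₁ l₂ η) ≠ 0) :
    (jacobianMatrix l₂ x η t).det = -(((l₂ : ℝ) - x.2) / Real.sin (Sinv l₁ l₂ η) + t) := by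
  rw [sin_Sinv] at hsin ⊢
  have hs := right_ne_zero_of_mul hsin
  have hcs := Real.cos_sq_add_sin_sq η
  rw [jacobianMatrix, Matrix.det_fin_two_of]
  rcases neg_one_zpow_eq_or l₂ with h | h <;> rw [h] <;> field_simp <;>
    linear_combination -(t * Real.sin η) * hcs

theorem hasFDerivAt_yOf (l₁ l₂ : ℤ) (x : ℝ × ℝ) (η t : ℝ) (hs : Real.sin η ≠ 0) :
    HasFDerivAt (yOf l₁ l₂ x)
      (LinearMap.toContinuousLinearMap (Matrix.toLin (Module.Basis.finTwoProd ℝ)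
        (Module.Basis.finTwoProd ℝ) (jacobianMatrix l₂ x η t))) (η, t) := by
  have hfst : HasFDerivAt (Prod.fst : ℝ × ℝ → ℝ) (ContinuousLinearMap.fst ℝ ℝ ℝ) (η, t) :=
    hasFDerivAt_fst
  have hsnd : HasFDerivAt (Prod.snd : ℝ × ℝ → ℝ) (ContinuousLinearMap.snd ℝ ℝ ℝ) (η, t) :=
    hasFDerivAt_snd
  have hcot := (((Real.hasDerivAt_cos η).div (Real.hasDerivAt_sin η) hs).comp_hasFDerivAt
    (η, t) hfst).const_mul ((-1:ℝ) ^ l₂ * ((l₂ : ℝ) - x.2))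
  have hcos := hsnd.mul ((Real.hasDerivAt_cos η).comp_hasFDerivAt (η, t) hfst)
  have hsin := hsnd.mul ((Real.hasDerivAt_sin η).comp_hasFDerivAt (η, t) hfst)
  have hy := ((hcot.const_add (-(-1:ℝ) ^ l₁ * l₁ + (1 - (-1:ℝ) ^ l₁) / 2 + (-1:ℝ) ^ l₁ * x.1)).add
    hcos).prodMk (hsin.const_add ((1 - (-1:ℝ) ^ l₂) / 2))
  rw [funext (yOf_eq l₁ l₂ x), jacobianMatrix, Matrix.toLin_finTwoProd_toContinuousLinearMap]
  refine hy.congr_fderiv ?_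
  have hcs := Real.cos_sq_add_sin_sq η
  ext <;> simp
  · field_simp
    linear_combination -(l₂ - x.2) * (-1:ℝ) ^ l₂ * hcs

/-- the Jacobian determinant of `(η,t) ↦ y(η,t)` equals
`|(l₂ - x₂)/sin θ + t|`, where `θ = S⁻¹_{l₁,l₂}(η)`; and when `t ≥ 0` and
`(l₂ - x₂)/sin θ > 0`, it equals `|R_{l₁,l₂}(y(η,t)) - x|`. -/
theorem statement15 (l₁ l₂ : ℤ) (x : ℝ × ℝ)
    (hx : x ∈ Ioo (0:ℝ) 1 ×ˢ Ioo (0:ℝ) 1)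
    (η t : ℝ) (hsin : Real.sin (Sinv l₁ l₂ η) ≠ 0) :
    ∃ A : (ℝ × ℝ) →L[ℝ] (ℝ × ℝ),
      HasFDerivAt (yOf l₁ l₂ x) A (η, t) ∧
      |LinearMap.det (A : (ℝ × ℝ) →ₗ[ℝ] (ℝ × ℝ))| =
        |((l₂ : ℝ) - x.2) / Real.sin (Sinv l₁ l₂ η) + t| ∧
      (0 ≤ t → 0 < ((l₂ : ℝ) - x.2) / Real.sin (Sinv l₁ l₂ η) →
        |LinearMap.det (A : (ℝ × ℝ) →ₗ[ℝ] (ℝ × ℝ))| =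
          enorm2 (Rmap l₁ l₂ (yOf l₁ l₂ x (η, t)) - x)) := by
  have hs : Real.sin η ≠ 0 := by
    rw [sin_Sinv] at hsin
    exact right_ne_zero_of_mul hsin
  refine ⟨_, hasFDerivAt_yOf l₁ l₂ x η t hs, ?_⟩
  rw [LinearMap.coe_toContinuousLinearMap, LinearMap.det_toLin, det_jacobianMatrix l₁ l₂ x η t hsin,
    abs_neg, Rmap_yOf_sub l₁ l₂ x η t hsin, enorm2_smul_cos_sin]
  exact ⟨rfl, fun _ _ => rfl⟩

end BRT15

end
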